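/- If γ > −1/2 and τ ∈ ℝ, then the entire function E(z) = ₁F₁(γ+iτ; 2γ+1; iz)·e^{−iz/2} belongs to the Hermite–Biehler class: E has no zeros in the open upper half-plane {z : Im(z) > 0} and satisfies |E(z)| ≥ |E(z̄)| whenever Im(z) > 0. -/

import Mathlib

open MeasureTheory Filter Set Topology ComplexConjugate

noncomputable section

/-- Rising factorial (Pochhammer symbol) `(v)_k`. -/
def risingFac (v : ℂ) (k : ℕ) : ℂ := (ascPochhammer ℂ k).eval v

/-- Real rising factorial. -/
def risingFacR (v : ℝ) (k : ℕ) : ℝ := (ascPochhammer ℝ k).eval v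

/-- The confluent hypergeometric function `₁F₁(a;b;z)`. -/
def oneF1 (a b z : ℂ) : ℂ :=
  ∑' k : ℕ, risingFac a k / risingFac b k * z ^ k / (Nat.factorial k : ℂ)

/-- The terminating Gauss hypergeometric sum `₂F₁(-m, c; d; x)`. -/
def twoF1t (m : ℕ) (c d x : ℂ) : ℂ :=
  ∑ k ∈ Finset.range (m + 1), (m.choose k : ℂ) * (risingFac c k / risingFac d k) * (-x) ^ k

/-- Real version of the terminating Gauss hypergeometric sum. -/
def twoF1tR (m : ℕ) (c d x : ℝ) : ℝ :=
  ∑ k ∈ Finset.range (m + 1), (m.choose k : ℝ) * (risingFacR c k / risingFacR d k) * (-x) ^ k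

/-- The polynomial reproducing kernel built from a family of polynomials. -/
def repKernel (φ : ℕ → Polynomial ℂ) (n : ℕ) (z w : ℂ) : ℂ :=
  ∑ j ∈ Finset.range (n + 1), (φ j).eval z * conj ((φ j).eval w)

/-- `φ` is the family of orthonormal polynomials of `μ`, with (positive real) leading
coefficients `κ`. -/
structure IsOrthonormalPolys (μ : Measure ℂ) (φ : ℕ → Polynomial ℂ) (κ : ℕ → ℝ) : Prop where
  natDegree_eq : ∀ n, (φ n).natDegree = n
  lead_pos : ∀ n, 0 < κ n
  lead_eq : ∀ n, (φ n).leadingCoeff = (κ n : ℂ)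
  orthonormal : ∀ m n, ∫ z, (φ m).eval z * conj ((φ n).eval z) ∂μ = if m = n then 1 else 0

/-- The (closed) support of a measure on `ℂ`. -/
def msupport (μ : Measure ℂ) : Set ℂ := {z | ∀ U : Set ℂ, IsOpen U → z ∈ U → 0 < μ U}

/-- Logarithmic capacity of a compact set, defined via the transfinite diameter. -/
def capacity (K : Set ℂ) : ℝ :=
  ⨅ n : ℕ, ⨆ f : {f : Fin (n + 2) → ℂ // ∀ i, f i ∈ K},
    (∏ p ∈ Finset.univ.filter (fun p : Fin (n + 2) × Fin (n + 2) => p.1 < p.2),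
        ‖f.1 p.1 - f.1 p.2‖) ^ (2 / (((n : ℝ) + 2) * ((n : ℝ) + 1)))

/-- Stahl–Totik regularity of a measure `μ` whose orthonormal polynomials have leading
coefficients `κ`:  `κ n ^ (1/n) → 1 / cap (supp μ)`. -/
def IsRegularST (μ : Measure ℂ) (κ : ℕ → ℝ) : Prop :=
  Tendsto (fun n : ℕ => κ n ^ ((n : ℝ)⁻¹)) atTop (𝓝 (1 / capacity (msupport μ)))

/-- The Christoffel function `λ_n(z; μ)`. -/
def christoffel (μ : Measure ℂ) (n : ℕ) (z : ℂ) : ℝ :=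
  sInf {x : ℝ | ∃ P : Polynomial ℂ, P.natDegree ≤ n ∧ P.eval z = 1 ∧
    x = ∫ w, ‖P.eval w‖ ^ 2 ∂μ}

/-- Arclength measure `dθ` on the unit circle (parametrized over `[0, 2π]`). -/
def circleArc : Measure ℂ :=
  Measure.map (fun θ : ℝ => Complex.exp (Complex.I * θ)) (volume.restrict (Icc (0:ℝ) (2 * Real.pi)))

/-- The measure `w(θ) dθ/(2π)` on the unit circle. -/
def circleAC (w : ℝ → ℝ) : Measure ℂ :=
  Measure.map (fun θ : ℝ => Complex.exp (Complex.I * θ))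
    ((volume.restrict (Icc (0:ℝ) (2 * Real.pi))).withDensity fun θ =>
      ENNReal.ofReal (w θ / (2 * Real.pi)))

/-- The Hua–Pickrell weight. -/
def hpWeight (γ τ : ℝ) (θ : ℝ) : ℝ :=
  (4:ℝ) ^ γ * ‖Complex.Gamma (1 + (γ:ℂ) + Complex.I * (τ:ℂ))‖ ^ 2
      / Real.Gamma (2 * γ + 1)
    * Real.exp ((Real.pi - θ) * τ) * Real.sin (θ / 2) ^ (2 * γ)

/-- The Hua–Pickrell measure on the unit circle. -/
def huaPickrell (γ τ : ℝ) : Measure ℂ := circleAC (hpWeight γ τ)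

/-- The limiting kernel appearing in Theorem 1.1, with the diagonal `a = b̄` interpreted
by continuity. -/
def hpLimitKernel (γ τ : ℝ) (a b : ℂ) : ℂ :=
  let y : ℂ := (γ:ℂ) + Complex.I * (τ:ℂ)
  let c : ℂ := 2 * (γ:ℂ) + 1
  if a = conj b then
    oneF1 (1 + conj y) c (-Complex.I * conj b) * oneF1 (2 + y) (c + 1) (Complex.I * conj b)
        * (1 + y)
      - oneF1 (conj y) c (-Complex.I * conj b) * oneF1 (1 + y) (c + 1) (Complex.I * conj b) * y
  else
    c * (oneF1 (conj y) c (-Complex.I * conj b) * oneF1 y c (Complex.I * a)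
        - oneF1 (1 + conj y) c (-Complex.I * conj b) * oneF1 (1 + y) c (Complex.I * a))
      / (Complex.I * (conj b - a))

/-- The lemniscate region `G_{r,m} = {z : |z^m - 1| < r^m}`. -/
def lemniscate (r : ℝ) (m : ℕ) : Set ℂ := {z : ℂ | ‖z ^ m - 1‖ < r ^ m}

/-- The function `H = ₁F₁(2;3;·)`. -/
def Hfun (t : ℂ) : ℂ := if t = 0 then 1 else 2 * (Complex.exp t * (t - 1) + 1) / t ^ 2

/-- The function `T` of (2.1). -/
def Tfun (γ : ℝ) (a : ℝ) : ℂ :=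
  oneF1 (1 + (γ:ℂ)) (2 * (γ:ℂ) + 1) (-Complex.I * (a:ℂ))
      * oneF1 (2 + (γ:ℂ)) (2 * (γ:ℂ) + 2) (Complex.I * (a:ℂ)) * (1 + (γ:ℂ))
    - oneF1 (γ:ℂ) (2 * (γ:ℂ) + 1) (-Complex.I * (a:ℂ))
      * oneF1 (1 + (γ:ℂ)) (2 * (γ:ℂ) + 2) (Complex.I * (a:ℂ)) * (γ:ℂ)

end

lemma rf_zero (v : ℂ) : risingFac v 0 = 1 := by simp [risingFac]

lemma rf_succ (v : ℂ) (k : ℕ) : risingFac v (k+1) = risingFac v k * (v + k) := by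
  simp [risingFac, ascPochhammer_succ_eval]

lemma rf_succ_left (v : ℂ) (k : ℕ) : risingFac v (k+1) = v * risingFac (v+1) k := by
  induction k with
  | zero => simp [rf_succ, rf_zero]
  | succ n ih => rw [rf_succ, ih, rf_succ]; push_cast; ring

lemma add_nat_ne {b : ℂ} (hb : 0 < b.re) (k : ℕ) : b + k ≠ 0 := by
  intro h
  have h2 := congrArg Complex.re h
  simp at h2
  have : (0:ℝ) ≤ k := k.cast_nonneg
  linarith

lemma rf_ne {b : ℂ} (hb : 0 < b.re) (k : ℕ) : risingFac b k ≠ 0 := by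
  induction k with
  | zero => simp [rf_zero]
  | succ n ih => rw [rf_succ]; exact mul_ne_zero ih (add_nat_ne hb n)

lemma coef_bound (a : ℂ) {b : ℂ} (hb : 0 < b.re) (k : ℕ) :
    ‖risingFac a k / risingFac b k‖ ≤ (1 + ‖a - b‖ / b.re) ^ k := by
  induction k with
  | zero => simp [rf_zero]
  | succ n ih =>
    have h1 : risingFac a (n+1) / risingFac b (n+1)
        = (risingFac a n / risingFac b n) * (1 + (a - b) / (b + n)) := by
      rw [rf_succ, rf_succ]
      have := add_nat_ne hb n
      have := rf_ne hb n
      field_simp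
      ring
    rw [h1, norm_mul, pow_succ]
    have h2 : b.re ≤ ‖b + n‖ := by
      refine le_trans ?_ (Complex.re_le_norm _)
      simp
    gcongr
    refine (norm_add_le _ _).trans ?_
    rw [norm_one, norm_div]
    gcongr

/-- Exponential-type series. -/
lemma summ_aux (c : ℕ → ℂ) (K : ℝ) (hc : ∀ k, ‖c k‖ ≤ K ^ k) (z : ℂ) :
    Summable (fun k : ℕ => ‖c k * z ^ k / (Nat.factorial k : ℂ)‖) := by
  refine Summable.of_nonneg_of_le (fun _ => norm_nonneg _) (fun k => ?_)
    (Real.summable_pow_div_factorial (K * ‖z‖))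
  rw [norm_div, norm_mul, norm_pow, Complex.norm_natCast, mul_pow]
  gcongr
  exact hc k

lemma deriv_aux (c : ℕ → ℂ) (K : ℝ) (hK : 0 ≤ K) (hc : ∀ k, ‖c k‖ ≤ K ^ k) (z : ℂ) :
    HasDerivAt (fun z : ℂ => ∑' k : ℕ, c k * z ^ k / (Nat.factorial k : ℂ))
      (∑' k : ℕ, c k * (k * z ^ (k-1)) / (Nat.factorial k : ℂ)) z ∧
    Summable (fun k : ℕ => c k * (k * z ^ (k-1)) / (Nat.factorial k : ℂ)) := by
  set R := ‖z‖ + 1 with hR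
  have hR0 : 0 ≤ R := by positivity
  have hu : Summable (fun k : ℕ => K ^ k * (k * R ^ (k-1)) / (Nat.factorial k : ℝ)) := by
    rw [← summable_nat_add_iff 1]
    refine ((Real.summable_pow_div_factorial (K * R)).mul_left K).congr (fun k => ?_)
    rw [Nat.factorial_succ]
    push_cast
    have : (Nat.factorial k : ℝ) ≠ 0 := by positivity
    have : (k : ℝ) + 1 ≠ 0 := by positivity
    field_simp
    ring
  have hb : ∀ k : ℕ, ∀ y ∈ Metric.ball (0:ℂ) R,
      ‖c k * (k * y ^ (k-1)) / (Nat.factorial k : ℂ)‖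
        ≤ K ^ k * (k * R ^ (k-1)) / (Nat.factorial k : ℝ) := by
    intro k y hy
    have hy' : ‖y‖ ≤ R := by simpa using (mem_ball_zero_iff.1 hy).le
    rw [norm_div, norm_mul, norm_mul, norm_pow, Complex.norm_natCast, Complex.norm_natCast]
    gcongr
    exact hc k
  have hz : z ∈ Metric.ball (0:ℂ) R := by simp [hR]
  refine ⟨hasDerivAt_tsum_of_isPreconnected hu Metric.isOpen_ball
    (convex_ball (0:ℂ) R).isPreconnected (fun k y hy => ?_) hb
    (Metric.mem_ball_self (by positivity : (0:ℝ) < R)) (summ_aux c K hc 0).of_norm hz,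
    Summable.of_norm_bounded hu (fun k => hb k z hz)⟩
  exact ((hasDerivAt_pow k y).const_mul (c k)).div_const _

lemma F_summ (a : ℂ) {b : ℂ} (hb : 0 < b.re) (z : ℂ) :
    Summable (fun k : ℕ => ‖risingFac a k / risingFac b k * z ^ k / (Nat.factorial k : ℂ)‖) :=
  summ_aux _ _ (coef_bound a hb) z

lemma F_deriv (a : ℂ) {b : ℂ} (hb : 0 < b.re) (z : ℂ) :
    ∃ d, HasDerivAt (oneF1 a b) d z ∧ z * d = a * (oneF1 (a+1) b z - oneF1 a b z) := by
  obtain ⟨h1, h2⟩ := deriv_aux _ _ (by positivity) (coef_bound a hb) z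
  refine ⟨_, h1, ?_⟩
  unfold oneF1
  rw [← (F_summ (a+1) hb z).of_norm.tsum_sub (F_summ a hb z).of_norm, ← tsum_mul_left,
    ← tsum_mul_left]
  refine tsum_congr (fun k => ?_)
  have h3 : a * risingFac (a+1) k = risingFac a k * (a + k) := by
    rw [← rf_succ_left, rf_succ]
  have h4 : z * (k * z ^ (k-1)) = k * z ^ k := by
    cases k with
    | zero => simp
    | succ n => simp only [Nat.add_sub_cancel]; ring
  calc _ = risingFac a k / risingFac b k * (z * (k * z ^ (k-1))) / (Nat.factorial k : ℂ) := by ring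
    _ = _ := by
      rw [h4]
      linear_combination (-(z ^ k / risingFac b k / (Nat.factorial k : ℂ))) * h3

lemma vand (n : ℕ) : ∀ (x b : ℂ), 0 < b.re →
    ∑ k ∈ Finset.range (n+1), (n.choose k : ℂ) * ((-1) ^ k * (risingFac x k / risingFac b k))
      = risingFac (b - x) n / risingFac b n := by
  induction n with
  | zero => intro x b hb; simp [rf_zero]
  | succ n ih =>
    intro x b hb
    have hb1 : 0 < (b+1).re := by simp; linarith
    have key : ∑ k ∈ Finset.range (n+2), ((n+1).choose k : ℂ) * ((-1) ^ k * (risingFac x k / risingFac b k))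
      = ∑ k ∈ Finset.range (n+1), (n.choose k : ℂ) * ((-1) ^ k * (risingFac x k / risingFac b k))
        - x / b * ∑ k ∈ Finset.range (n+1), (n.choose k : ℂ) * ((-1) ^ k * (risingFac (x+1) k / risingFac (b+1) k)) := by
      rw [Finset.sum_range_succ']
      simp only [Nat.choose_succ_succ, Nat.cast_add, add_mul, Finset.sum_add_distrib]
      have e1 : ∑ k ∈ Finset.range (n+1), (n.choose (k+1) : ℂ) * ((-1) ^ (k+1) * (risingFac x (k+1) / risingFac b (k+1))) +
        (n.choose 0 : ℂ) * ((-1) ^ 0 * (risingFac x 0 / risingFac b 0)) = ∑ k ∈ Finset.range (n+1), (n.choose k : ℂ) * ((-1) ^ k * (risingFac x k / risingFac b k)) := by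
        rw [← Finset.sum_range_succ' (fun k => (n.choose k : ℂ) * ((-1) ^ k * (risingFac x k / risingFac b k))), Finset.sum_range_succ]
        simp
      have e2 : ∑ k ∈ Finset.range (n+1), (n.choose k : ℂ) * ((-1) ^ (k+1) * (risingFac x (k+1) / risingFac b (k+1))) = - (x / b * ∑ k ∈ Finset.range (n+1), (n.choose k : ℂ) * ((-1) ^ k * (risingFac (x+1) k / risingFac (b+1) k))) := by
        rw [Finset.mul_sum, ← Finset.sum_neg_distrib]
        refine Finset.sum_congr rfl (fun k _ => ?_)
        rw [rf_succ_left, rf_succ_left, mul_div_mul_comm]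
        ring
      rw [← e1, e2]
      simp
      ring
    rw [key, ih x b hb, ih (x+1) (b+1) hb1, rf_succ, rf_succ, add_sub_add_right_eq_sub]
    have h0 : b ≠ 0 := by simpa using add_nat_ne hb 0
    have h1 := add_nat_ne hb n
    have h2 := rf_ne hb n
    have h3 := rf_ne hb1 n
    have h4 : risingFac b n * (b + n) = b * risingFac (b+1) n := by
      rw [← rf_succ_left, rf_succ]
    have h5 : risingFac (b+1) n = risingFac b n * (b + n) / b := by
      rw [h4]; field_simp
    rw [h5]
    field_simp
    ring

lemma kummer (a : ℂ) {b : ℂ} (hb : 0 < b.re) (z : ℂ) :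
    Complex.exp z * oneF1 a b (-z) = oneF1 (b - a) b z := by
  have he : Complex.exp z = ∑' k : ℕ, z ^ k / (Nat.factorial k : ℂ) := by
    rw [Complex.exp_eq_exp_ℂ, NormedSpace.exp_eq_tsum_div]
  have hs : Summable (fun k : ℕ => ‖z ^ k / (Nat.factorial k : ℂ)‖) := by
    simpa using summ_aux (fun _ => 1) 1 (by simp) z
  rw [he]
  unfold oneF1
  rw [mul_comm, tsum_mul_tsum_eq_tsum_sum_antidiagonal_of_summable_norm (F_summ a hb (-z)) hs]
  refine tsum_congr (fun n => ?_)
  rw [← vand n a b hb, Finset.Nat.sum_antidiagonal_eq_sum_range_succ_mk, Finset.sum_mul,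
    Finset.sum_div]
  refine Finset.sum_congr rfl (fun k hk => ?_)
  have hk' : k ≤ n := Nat.lt_succ_iff.1 (Finset.mem_range.1 hk)
  have h1 : (n.choose k : ℂ) * (Nat.factorial k * Nat.factorial (n-k)) = Nat.factorial n := by
    rw [← mul_assoc]; exact_mod_cast Nat.choose_mul_factorial_mul_factorial hk'
  have f1 : (Nat.factorial k : ℂ) ≠ 0 := by exact_mod_cast Nat.factorial_ne_zero _
  have f2 : (Nat.factorial (n-k) : ℂ) ≠ 0 := by exact_mod_cast Nat.factorial_ne_zero _
  have f3 : (n.choose k : ℂ) ≠ 0 := by exact_mod_cast (Nat.choose_pos hk').ne'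
  have h2 : z ^ n = z ^ k * z ^ (n-k) := by rw [← pow_add]; congr 1; omega
  rw [← h1, h2, neg_pow z k]
  field_simp

lemma rf_conj (a : ℂ) (k : ℕ) : conj (risingFac a k) = risingFac (conj a) k := by
  induction k with
  | zero => simp [rf_zero]
  | succ n ih => simp [rf_succ, ih]

lemma F_conj (a b z : ℂ) : conj (oneF1 a b z) = oneF1 (conj a) (conj b) (conj z) := by
  unfold oneF1
  rw [Complex.conj_tsum]
  refine tsum_congr (fun k => ?_)
  simp [rf_conj]

lemma F_zero (a b : ℂ) : oneF1 a b 0 = 1 := by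
  unfold oneF1
  rw [tsum_eq_single 0]
  · simp [rf_zero]
  · intro k hk; simp [hk]

lemma G_deriv (a b : ℂ) (hb : 0 < b.re) (hab : a + conj a + 1 = b) (z : ℂ) :
    ∃ d, HasDerivAt (oneF1 (a+1) b) d z ∧
      z * d = conj a * (oneF1 a b z - oneF1 (a+1) b z) + z * oneF1 (a+1) b z := by
  have hG : oneF1 (a+1) b = fun z => Complex.exp z * oneF1 (conj a) b (-z) := by
    funext z
    rw [kummer _ hb]; congr 1; rw [← hab]; ring
  obtain ⟨d, hd, hd2⟩ := F_deriv (conj a) hb (-z)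
  have h1 := (Complex.hasDerivAt_exp z).mul (hd.comp z (hasDerivAt_neg z))
  have hF : oneF1 a b z = Complex.exp z * oneF1 (conj a + 1) b (-z) := by
    rw [kummer _ hb]; congr 1; rw [← hab]; ring
  rw [hG, hF]
  refine ⟨_, h1, ?_⟩
  simp only [Function.comp]
  linear_combination Complex.exp z * hd2

lemma main_pos (γ : ℝ) (hγ : -(1/2) < γ) (a b : ℂ) (hre : a.re = γ)
    (hab : a + conj a + 1 = b) (w : ℂ) (hw : w.re < 0) :
    ‖oneF1 (a+1) b w‖ ^ 2 < ‖oneF1 a b w‖ ^ 2 := by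
  have hb : 0 < b.re := by rw [← hab]; simp [hre]; linarith
  set F : ℝ → ℂ := fun s => oneF1 a b (s * w) with hF
  set G : ℝ → ℂ := fun s => oneF1 (a+1) b (s * w) with hG
  have hFd : ∀ s : ℝ, ∃ d, HasDerivAt F d s ∧ s * d = a * (G s - F s) := by
    intro s
    obtain ⟨d, hd, hd2⟩ := F_deriv a hb (s * w)
    have hl : HasDerivAt (fun s : ℝ => (s:ℂ) * w) (1 * w) s :=
      (Complex.ofRealCLM.hasDerivAt (x := s)).mul_const w
    have hc := HasDerivAt.comp s hd hl
    refine ⟨d * (1 * w), hc, ?_⟩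
    rw [← hd2]; ring
  have hGd : ∀ s : ℝ, ∃ d, HasDerivAt G d s ∧
      s * d = conj a * (F s - G s) + s * w * G s := by
    intro s
    obtain ⟨d, hd, hd2⟩ := G_deriv a b hb hab (s * w)
    have hl : HasDerivAt (fun s : ℝ => (s:ℂ) * w) (1 * w) s :=
      (Complex.ofRealCLM.hasDerivAt (x := s)).mul_const w
    have hc := HasDerivAt.comp s hd hl
    refine ⟨d * (1 * w), hc, ?_⟩
    rw [← hd2]; ring
  set D : ℝ → ℝ := fun s => ‖F s‖ ^ 2 - ‖G s‖ ^ 2 with hD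
  have hDd : ∀ s : ℝ, ∃ d, HasDerivAt D d s ∧
      s * d = -2 * γ * D s + s * (-2 * w.re * ‖G s‖ ^ 2) := by
    intro s
    obtain ⟨d, hd, hd2⟩ := hFd s
    obtain ⟨e, he, he2⟩ := hGd s
    refine ⟨_, hd.norm_sq.sub he.norm_sq, ?_⟩
    have r1 := congrArg Complex.re hd2
    have r2 := congrArg Complex.im hd2
    have r3 := congrArg Complex.re he2
    have r4 := congrArg Complex.im he2
    simp only [hD, Complex.sq_norm, Complex.normSq_apply, Complex.inner]
    simp [hre] at r1 r2 r3 r4 ⊢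
    linear_combination 2 * (F s).re * r1 + 2 * (F s).im * r2 - 2 * (G s).re * r3 - 2 * (G s).im * r4
  set f : ℝ → ℝ := fun s => s ^ (2 * γ) * D s with hf
  have hfd : ∀ s : ℝ, 0 < s → HasDerivAt f (s ^ (2*γ) * (-2 * w.re * ‖G s‖ ^ 2)) s := by
    intro s hs
    obtain ⟨d, hd, hd2⟩ := hDd s
    refine ((Real.hasDerivAt_rpow_const (p := 2 * γ) (Or.inl hs.ne')).mul hd).congr_deriv ?_
    rw [Real.rpow_sub_one hs.ne']
    have : d = (-2 * γ * D s + s * (-2 * w.re * ‖G s‖ ^ 2)) / s := by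
      rw [← hd2]; field_simp
    rw [this]
    field_simp
    ring
  have hmono : MonotoneOn f (Ioi 0) := by
    apply monotoneOn_of_deriv_nonneg (convex_Ioi 0)
    · intro s hs; exact (hfd s hs).continuousAt.continuousWithinAt
    · intro s hs; rw [interior_Ioi] at hs
      exact (hfd s hs).differentiableAt.differentiableWithinAt
    · intro s hs; rw [interior_Ioi] at hs
      rw [(hfd s hs).deriv]
      have : 0 < s ^ (2*γ) := Real.rpow_pos_of_pos hs _
      have : 0 < -2 * w.re := by linarith
      positivity
  have hF0 : F 0 = 1 := by simp [hF, F_zero]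
  have hG0 : G 0 = 1 := by simp [hG, F_zero]
  have hlim : Tendsto f (𝓝[>] 0) (𝓝 0) := by
    obtain ⟨d, hd, -⟩ := hDd 0
    have hD0 : D 0 = 0 := by simp [hD, hF0, hG0]
    have h1 : Tendsto (fun s : ℝ => s⁻¹ * D s) (𝓝[>] 0) (𝓝 d) := by
      have := hd.tendsto_slope_zero_right
      simpa [hD0] using this
    have h2 : Tendsto (fun s : ℝ => s ^ (2*γ+1)) (𝓝[>] 0) (𝓝 0) := by
      have hc := (Real.continuousAt_rpow_const 0 (2*γ+1) (Or.inr (by linarith))).tendsto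
      rw [Real.zero_rpow (by linarith)] at hc
      exact hc.mono_left nhdsWithin_le_nhds
    have h3 := h2.mul h1
    rw [zero_mul] at h3
    refine h3.congr' ?_
    filter_upwards [self_mem_nhdsWithin] with s hs
    have hs' : s ≠ 0 := ne_of_gt hs
    rw [Real.rpow_add_one hs', hf]
    field_simp
  have hnn : ∀ s : ℝ, 0 < s → 0 ≤ f s := by
    intro s hs
    refine le_of_tendsto hlim ?_
    filter_upwards [Ioo_mem_nhdsGT hs] with t ht
    exact hmono ht.1 hs ht.2.le
  have hD1 : D 1 = ‖oneF1 a b w‖ ^ 2 - ‖oneF1 (a+1) b w‖ ^ 2 := by simp [hD, hF, hG]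
  rw [← sub_pos, ← hD1]
  by_contra hcon
  have hf1 : f 1 ≤ 0 := by simp [hf]; linarith
  have hz : ∀ s ∈ Ioo (0:ℝ) 1, f s = 0 := fun s hs =>
    le_antisymm ((hmono hs.1 (by simp : (1:ℝ) ∈ Ioi 0) hs.2.le).trans hf1) (hnn s hs.1)
  have hGz : ∀ s ∈ Ioo (0:ℝ) 1, G s = 0 := by
    intro s hs
    have h1 : HasDerivAt f 0 s := by
      refine (hasDerivAt_const s (0:ℝ)).congr_of_eventuallyEq ?_
      filter_upwards [isOpen_Ioo.mem_nhds hs] with t ht using hz t ht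
    have h2 := (hfd s hs.1).unique h1
    have h3 : s ^ (2*γ) ≠ 0 := (Real.rpow_pos_of_pos hs.1 _).ne'
    simpa [h3, hw.ne] using h2
  have hGc : Tendsto G (𝓝[>] 0) (𝓝 1) := by
    obtain ⟨d, hd, -⟩ := hGd 0
    have := hd.continuousAt.tendsto
    rw [hG0] at this
    exact this.mono_left nhdsWithin_le_nhds
  have hGc' : Tendsto G (𝓝[>] 0) (𝓝 0) := by
    refine tendsto_const_nhds.congr' ?_
    filter_upwards [Ioo_mem_nhdsGT one_pos] with t ht using (hGz t ht).symm
  exact one_ne_zero (tendsto_nhds_unique hGc hGc')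

/-- The entire function `₁F₁(γ+iτ; 2γ+1; iz) e^{-iz/2}` is in the Hermite–Biehler class. -/
theorem statement_9
    (γ τ : ℝ) (hγ : -(1/2) < γ)
    (E : ℂ → ℂ)
    (hE : ∀ z, E z = oneF1 ((γ:ℂ) + Complex.I * (τ:ℂ)) (2 * (γ:ℂ) + 1) (Complex.I * z)
      * Complex.exp (-Complex.I * z / 2)) :
    Differentiable ℂ E ∧
    (∀ z : ℂ, 0 < z.im → E z ≠ 0) ∧
    (∀ z : ℂ, 0 < z.im → ‖E (conj z)‖ ≤ ‖E z‖) := by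
  set a : ℂ := (γ:ℂ) + Complex.I * (τ:ℂ) with ha
  set b : ℂ := 2 * (γ:ℂ) + 1 with hb
  have hre : a.re = γ := by simp [ha]
  have hbre : 0 < b.re := by simp [hb]; linarith
  have hab : a + conj a + 1 = b := by simp [ha, hb]; ring
  have hbc : conj b = b := by simp [hb, map_ofNat (starRingEnd ℂ) 2]
  have hlt : ∀ z : ℂ, 0 < z.im → ‖E (conj z)‖ < ‖E z‖ := by
    intro z hz
    have h1 := main_pos γ hγ a b hre hab (Complex.I * z) (by simpa using hz)
    have h2 : ‖oneF1 (a+1) b (Complex.I * z)‖ < ‖oneF1 a b (Complex.I * z)‖ :=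
      lt_of_pow_lt_pow_left₀ 2 (norm_nonneg _) h1
    have h3 : E (conj z) = conj (oneF1 (a+1) b (Complex.I * z) * Complex.exp (-Complex.I * z / 2)) := by
      have hk : oneF1 (a+1) b (Complex.I * z)
          = Complex.exp (Complex.I * z) * oneF1 (conj a) b (-(Complex.I * z)) := by
        rw [kummer _ hbre]; congr 1; rw [← hab]; ring
      rw [hk, hE, map_mul, map_mul, F_conj, hbc, ← Complex.exp_conj, ← Complex.exp_conj,
        mul_right_comm, ← Complex.exp_add, mul_comm]
      congr 2
      · simp [map_ofNat (starRingEnd ℂ) 2]; ring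
      · simp
      · simp
    rw [h3, RCLike.norm_conj, hE z, norm_mul, norm_mul]
    exact mul_lt_mul_of_pos_right h2 (norm_pos_iff.2 (Complex.exp_ne_zero _))
  refine ⟨?_, fun z hz h0 => ?_, fun z hz => (hlt z hz).le⟩
  · have hF : Differentiable ℂ (oneF1 a b) := fun z => by
      obtain ⟨d, hd, -⟩ := F_deriv a hbre z
      exact hd.differentiableAt
    have : E = fun z => oneF1 a b (Complex.I * z) * Complex.exp (-Complex.I * z / 2) := funext hE
    rw [this]
    fun_prop
  · have := hlt z hz
    rw [h0, norm_zero] at this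
    exact absurd this (not_lt.2 (norm_nonneg _))
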